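/- arXiv:1103.2697 — 4 statements merged into one kernel-verified Lean document; each statement's English description precedes it below -/
import Mathlib

section
/- For every v ∈ ℝ^p one has ‖v‖_group ≤ ‖v‖_coop, and equality ‖v‖_group = ‖v‖_coop holds if and only if every group is sign-coherent at v, i.e., for each k = 1,…,K either (v_{G_k})⁺ = 0 or (v_{G_k})⁻ = 0. -/
open scoped BigOperators

/-- Euclidean norm of the positive part of `v` restricted to the index set `G`. -/
noncomputable def enormP {α : Type*} (G : Finset α) (v : α → ℝ) : ℝ :=
  Real.sqrt (∑ j ∈ G, (max (v j) 0) ^ 2)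

/-- Euclidean norm of the negative part of `v` restricted to the index set `G`. -/
noncomputable def enormN {α : Type*} (G : Finset α) (v : α → ℝ) : ℝ :=
  Real.sqrt (∑ j ∈ G, (max (-v j) 0) ^ 2)

/-- Euclidean norm of `v` restricted to the index set `G`. -/
noncomputable def enorm {α : Type*} (G : Finset α) (v : α → ℝ) : ℝ :=
  Real.sqrt (∑ j ∈ G, (v j) ^ 2)

/-- The cooperative-Lasso norm associated with groups `G k` and weights `w k`. -/
noncomputable def coopNorm {p K : ℕ} (G : Fin K → Finset (Fin p)) (w : Fin K → ℝ)
    (v : Fin p → ℝ) : ℝ :=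
  ∑ k, w k * (enormP (G k) v + enormN (G k) v)

/-- The group-Lasso norm associated with groups `G k` and weights `w k`. -/
noncomputable def groupNorm {p K : ℕ} (G : Fin K → Finset (Fin p)) (w : Fin K → ℝ)
    (v : Fin p → ℝ) : ℝ :=
  ∑ k, w k * enorm (G k) v

theorem aux_sq {α : Type*} (G : Finset α) (v : α → ℝ) :
    0 ≤ _root_.enorm G v ∧ 0 ≤ enormP G v ∧ 0 ≤ enormN G v ∧
      (_root_.enorm G v) ^ 2 = (enormP G v) ^ 2 + (enormN G v) ^ 2 := by
  refine ⟨Real.sqrt_nonneg _, Real.sqrt_nonneg _, Real.sqrt_nonneg _, ?_⟩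
  unfold _root_.enorm enormP enormN
  rw [Real.sq_sqrt (Finset.sum_nonneg fun _ _ => sq_nonneg _),
    Real.sq_sqrt (Finset.sum_nonneg fun _ _ => sq_nonneg _),
    Real.sq_sqrt (Finset.sum_nonneg fun _ _ => sq_nonneg _), ← Finset.sum_add_distrib]
  refine Finset.sum_congr rfl fun j _ => ?_
  rcases le_total (v j) 0 with h | h
  · rw [max_eq_right h, max_eq_left (by linarith)]; ring
  · rw [max_eq_left h, max_eq_right (by linarith)]; ring

theorem aux_sqrt {α : Type*} (G : Finset α) (f : α → ℝ) :
    Real.sqrt (∑ j ∈ G, (f j) ^ 2) = 0 ↔ ∀ j ∈ G, f j = 0 := by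
  rw [Real.sqrt_eq_zero (Finset.sum_nonneg fun _ _ => sq_nonneg _),
    Finset.sum_eq_zero_iff_of_nonneg (fun _ _ => sq_nonneg _)]
  simp

theorem aux_le {α : Type*} (G : Finset α) (v : α → ℝ) :
    _root_.enorm G v ≤ enormP G v + enormN G v := by
  obtain ⟨h0, h1, h2, h3⟩ := aux_sq G v
  exact abs_le_of_sq_le_sq' (by nlinarith [mul_nonneg h1 h2]) (by linarith) |>.2

theorem aux_eq {α : Type*} (G : Finset α) (v : α → ℝ) :
    _root_.enorm G v = enormP G v + enormN G v ↔
      (∀ j ∈ G, max (v j) 0 = 0) ∨ (∀ j ∈ G, max (-v j) 0 = 0) := by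
  obtain ⟨h0, h1, h2, h3⟩ := aux_sq G v
  rw [← aux_sqrt G (fun j => max (v j) 0), ← aux_sqrt G (fun j => max (-v j) 0)]
  change _ ↔ enormP G v = 0 ∨ enormN G v = 0
  rw [← mul_eq_zero]
  constructor
  · intro h
    rw [h] at h3
    linarith
  · intro h
    rw [← sq_eq_sq₀ h0 (by linarith), h3]
    linarith

/-- `‖v‖_group ≤ ‖v‖_coop`, with equality iff every group is
sign-coherent at `v`, i.e. for each `k` either `(v_{G_k})⁺ = 0` or `(v_{G_k})⁻ = 0`. -/
theorem groupNorm_le_coopNorm_iff_sign_coherent (p K : ℕ) (hp : 1 ≤ p)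
    (G : Fin K → Finset (Fin p))
    (hcover : ∀ j : Fin p, ∃ k, j ∈ G k)
    (hdisj : ∀ k l : Fin K, k ≠ l → Disjoint (G k) (G l))
    (w : Fin K → ℝ) (hw : ∀ k, 0 < w k) (v : Fin p → ℝ) :
    groupNorm G w v ≤ coopNorm G w v ∧
    (groupNorm G w v = coopNorm G w v ↔
      ∀ k, (∀ j ∈ G k, max (v j) 0 = 0) ∨ (∀ j ∈ G k, max (-v j) 0 = 0)) := by
  have hle : ∀ k ∈ Finset.univ, w k * _root_.enorm (G k) v ≤
      w k * (enormP (G k) v + enormN (G k) v) :=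
    fun k _ => mul_le_mul_of_nonneg_left (aux_le _ _) (hw k).le
  refine ⟨Finset.sum_le_sum hle, ?_⟩
  unfold groupNorm coopNorm
  rw [Finset.sum_eq_sum_iff_of_le hle]
  refine forall_congr' fun k => ?_
  rw [← aux_eq]
  simp [(hw k).ne']
end

section
/- A vector g ∈ ℝ^p is a subgradient at β ∈ ℝ^p of the coop-Lasso objective L (i.e., L(u) ≥ L(β) + ⟨g, u − β⟩ for all u ∈ ℝ^p) if and only if g = Xᵀ(Xβ − y) + λθ for some θ ∈ ℝ^p satisfying: for every k and every j ∈ G_k with β_j ≠ 0, θ_j = w_k β_j / ‖φ_j(β_{G_k})‖; and for every k and every j ∈ G_k with β_j = 0, ‖φ_j(θ_{G_k})‖ ≤ w_k. -/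
open scoped BigOperators

/-- `‖φ_j(v_G)‖`: the Euclidean norm of `φ_j(v_G)`, where `φ_j(v) = 0` if `v j = 0`,
`φ_j(v) = v⁺` if `v j > 0` and `φ_j(v) = v⁻` if `v j < 0`. -/
noncomputable def phiNorm {α : Type*} (G : Finset α) (v : α → ℝ) (j : α) : ℝ :=
  if 0 < v j then enormP G v else if v j < 0 then enormN G v else 0

/-- The coop-Lasso objective `L(β) = (1/2)‖y − Xβ‖² + λ‖β‖_coop`. -/
noncomputable def coopObj {p K n : ℕ} (G : Fin K → Finset (Fin p)) (w : Fin K → ℝ)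
    (X : Matrix (Fin n) (Fin p) ℝ) (y : Fin n → ℝ) (lam : ℝ) (β : Fin p → ℝ) : ℝ :=
  (1 / 2) * (∑ i, (y i - Matrix.mulVec X β i) ^ 2) + lam * coopNorm G w β

lemma enormP_nonneg {α : Type*} (G : Finset α) (v : α → ℝ) : 0 ≤ enormP G v := Real.sqrt_nonneg _

lemma enormN_eq {α : Type*} (G : Finset α) (v : α → ℝ) : enormN G v = enormP G (-v) := rfl

lemma enormP_sq {α : Type*} (G : Finset α) (v : α → ℝ) :
    enormP G v ^ 2 = ∑ j ∈ G, (max (v j) 0) ^ 2 :=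
  Real.sq_sqrt (Finset.sum_nonneg fun _ _ => sq_nonneg _)

lemma enormP_cs {α : Type*} (G : Finset α) (a b : α → ℝ) :
    ∑ j ∈ G, max (a j) 0 * max (b j) 0 ≤ enormP G a * enormP G b :=
  Real.sum_mul_le_sqrt_mul_sqrt G _ _

lemma enormP_add {α : Type*} (G : Finset α) (a b : α → ℝ) :
    enormP G (a + b) ≤ enormP G a + enormP G b := by
  have ha := enormP_nonneg G a
  have hb := enormP_nonneg G b
  apply Real.sqrt_le_iff.2 ⟨by positivity, ?_⟩
  have h1 : ∑ j ∈ G, (max ((a + b) j) 0) ^ 2 ≤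
      ∑ j ∈ G, ((max (a j) 0) ^ 2 + 2 * (max (a j) 0 * max (b j) 0) + (max (b j) 0) ^ 2) := by
    apply Finset.sum_le_sum
    intro j _
    have : max ((a + b) j) 0 ≤ max (a j) 0 + max (b j) 0 := by
      apply max_le
      · exact add_le_add (le_max_left _ _) (le_max_left _ _)
      · exact add_nonneg (le_max_right _ _) (le_max_right _ _)
    have h0 : 0 ≤ max ((a + b) j) 0 := le_max_right _ _
    nlinarith
  rw [Finset.sum_add_distrib, Finset.sum_add_distrib, ← Finset.mul_sum, ← enormP_sq G a, ← enormP_sq G b] at h1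
  have := enormP_cs G a b
  nlinarith

lemma enormP_smul {α : Type*} (G : Finset α) (t : ℝ) (ht : 0 ≤ t) (a : α → ℝ) :
    enormP G (t • a) = t * enormP G a := by
  have h : ∀ j, max ((t • a) j) 0 = t * max (a j) 0 := by
    intro j
    rw [mul_max_of_nonneg _ _ ht]; simp
  unfold enormP
  simp only [h, mul_pow]
  rw [← Finset.mul_sum, Real.sqrt_mul (sq_nonneg t), Real.sqrt_sq ht]

lemma coopNorm_add {p K : ℕ} (G : Fin K → Finset (Fin p)) (w : Fin K → ℝ) (hw : ∀ k, 0 < w k)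
    (a b : Fin p → ℝ) : coopNorm G w (a + b) ≤ coopNorm G w a + coopNorm G w b := by
  unfold coopNorm
  rw [← Finset.sum_add_distrib]
  apply Finset.sum_le_sum
  intro k _
  have h1 := enormP_add (G k) a b
  have h2 := enormP_add (G k) (-a) (-b)
  rw [← neg_add_rev, add_comm b a] at h2
  simp only [enormN_eq]
  rw [← mul_add]
  apply mul_le_mul_of_nonneg_left _ (hw k).le
  linarith

lemma coopNorm_smul {p K : ℕ} (G : Fin K → Finset (Fin p)) (w : Fin K → ℝ)
    (t : ℝ) (ht : 0 ≤ t) (a : Fin p → ℝ) : coopNorm G w (t • a) = t * coopNorm G w a := by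
  unfold coopNorm
  rw [Finset.mul_sum]
  apply Finset.sum_congr rfl
  intro k _
  simp only [enormN_eq]
  rw [← smul_neg, enormP_smul _ _ ht, enormP_smul _ _ ht]
  ring

lemma mul_le_parts (x y : ℝ) : x * y ≤ max x 0 * max y 0 + max (-x) 0 * max (-y) 0 := by
  rcases le_total x 0 with hx | hx <;> rcases le_total y 0 with hy | hy <;>
    simp [hx, hy] <;> nlinarith

lemma group_le {α : Type*} (G : Finset α) (θ v : α → ℝ) (w : ℝ)
    (hP : enormP G θ ≤ w) (hN : enormN G θ ≤ w) :
    ∑ j ∈ G, θ j * v j ≤ w * (enormP G v + enormN G v) := by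
  have h1 : ∑ j ∈ G, θ j * v j ≤
      ∑ j ∈ G, (max (θ j) 0 * max (v j) 0 + max (-θ j) 0 * max (-v j) 0) :=
    Finset.sum_le_sum fun j _ => mul_le_parts _ _
  rw [Finset.sum_add_distrib] at h1
  have h2 := enormP_cs G θ v
  have h3 := enormP_cs G (-θ) (-v)
  simp only [Pi.neg_apply, ← enormN_eq] at h3
  have h4 := mul_le_mul_of_nonneg_right hP (enormP_nonneg G v)
  have h5 := mul_le_mul_of_nonneg_right hN (enormP_nonneg G (-v))
  rw [← enormN_eq] at h5
  linarith

lemma enormP_pos {α : Type*} (G : Finset α) (v : α → ℝ) (j : α) (hj : j ∈ G) (h : 0 < v j) :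
    0 < enormP G v := by
  apply Real.sqrt_pos.2
  apply lt_of_lt_of_le _ (Finset.single_le_sum (f := fun j => (max (v j) 0) ^ 2)
    (fun i _ => sq_nonneg _) hj)
  have : 0 < max (v j) 0 := lt_max_of_lt_left h
  positivity

lemma group_eq {α : Type*} (G : Finset α) (θ β : α → ℝ) (w : ℝ) (hw : 0 < w)
    (hP : enormP G θ ≤ w) (hN : enormN G θ ≤ w)
    (he : ∑ j ∈ G, θ j * β j = w * (enormP G β + enormN G β))
    (j : α) (hj : j ∈ G) (hb : 0 < β j) : θ j = w * β j / enormP G β := by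
  have hpos := enormP_pos G β j hj hb
  set N := enormP G β with hNdef
  have h1 : ∑ j ∈ G, θ j * β j ≤
      ∑ j ∈ G, (max (θ j) 0 * max (β j) 0 + max (-θ j) 0 * max (-β j) 0) :=
    Finset.sum_le_sum fun j _ => mul_le_parts _ _
  rw [Finset.sum_add_distrib] at h1
  have h3 := enormP_cs G (-θ) (-β)
  simp only [Pi.neg_apply, ← enormN_eq] at h3
  have h5 := mul_le_mul_of_nonneg_right hN (enormP_nonneg G (-β))
  rw [← enormN_eq] at h5
  have h6 : w * N ≤ ∑ j ∈ G, max (θ j) 0 * max (β j) 0 := by linarith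
  have h7 : ∑ j ∈ G, (max (θ j) 0 - w / N * max (β j) 0) ^ 2 ≤ 0 := by
    have e : ∑ j ∈ G, (max (θ j) 0 - w / N * max (β j) 0) ^ 2
        = enormP G θ ^ 2 - 2 * (w / N) * (∑ j ∈ G, max (θ j) 0 * max (β j) 0)
          + (w / N) ^ 2 * N ^ 2 := by
      rw [hNdef, enormP_sq, enormP_sq, Finset.mul_sum, Finset.mul_sum, ← Finset.sum_sub_distrib,
        ← Finset.sum_add_distrib]
      apply Finset.sum_congr rfl
      intros; ring
    rw [e]
    have a1 : enormP G θ ^ 2 ≤ w ^ 2 := by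
      have := enormP_nonneg G θ
      gcongr
    have a2 : (w / N) * (w * N) ≤ (w / N) * (∑ j ∈ G, max (θ j) 0 * max (β j) 0) := by gcongr
    have a3 : (w / N) * (w * N) = w ^ 2 := by field_simp
    have a4 : (w / N) ^ 2 * N ^ 2 = w ^ 2 := by field_simp
    linarith
  have h8 := Finset.single_le_sum (f := fun j => (max (θ j) 0 - w / N * max (β j) 0) ^ 2)
    (fun i _ => sq_nonneg _) hj
  have h9 : max (θ j) 0 - w / N * max (β j) 0 = 0 := by
    apply pow_eq_zero_iff (two_ne_zero) |>.1
    exact le_antisymm (h8.trans h7) (sq_nonneg _)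
  rw [max_eq_left hb.le] at h9
  have h10 : 0 < w / N * β j := by positivity
  have h11 : max (θ j) 0 = θ j := by
    rcases max_choice (θ j) 0 with h | h
    · exact h
    · linarith
  rw [h11] at h9
  rw [mul_div_right_comm]; linarith

lemma group_bound {α : Type*} (G : Finset α) (θ β : α → ℝ) (w : ℝ) (hw : 0 < w)
    (h1 : ∀ j ∈ G, β j ≠ 0 → θ j = w * β j / phiNorm G β j)
    (h2 : ∀ j ∈ G, β j = 0 → phiNorm G θ j ≤ w) : enormP G θ ≤ w := by
  by_cases hex : ∃ j ∈ G, β j = 0 ∧ 0 < θ j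
  · obtain ⟨j, hj, hb, ht⟩ := hex
    have := h2 j hj hb
    rwa [phiNorm, if_pos ht] at this
  · push Not at hex
    have hle : ∀ j ∈ G, max (θ j) 0 ≤ w / enormP G β * max (β j) 0 := by
      intro j hj
      have hn : 0 ≤ w / enormP G β * max (β j) 0 :=
        mul_nonneg (div_nonneg hw.le (enormP_nonneg _ _)) (le_max_right _ _)
      apply max_le _ hn
      rcases lt_trichotomy (β j) 0 with hb | hb | hb
      · rw [h1 j hj hb.ne, phiNorm, if_neg hb.not_gt, if_pos hb]
        refine le_trans ?_ hn
        apply div_nonpos_of_nonpos_of_nonneg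
        · nlinarith
        · exact Real.sqrt_nonneg _
      · exact (hex j hj hb).trans hn
      · rw [h1 j hj hb.ne', phiNorm, if_pos hb, max_eq_left hb.le, mul_div_right_comm]
    apply Real.sqrt_le_iff.2 ⟨hw.le, ?_⟩
    calc ∑ j ∈ G, (max (θ j) 0) ^ 2 ≤ ∑ j ∈ G, (w / enormP G β) ^ 2 * (max (β j) 0) ^ 2 := by
          apply Finset.sum_le_sum
          intro j hj
          rw [← mul_pow]
          exact pow_le_pow_left₀ (le_max_right _ _) (hle j hj) 2
      _ = (w / enormP G β) ^ 2 * enormP G β ^ 2 := by rw [← Finset.mul_sum, enormP_sq]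
      _ ≤ w ^ 2 := by
          rcases eq_or_ne (enormP G β) 0 with h | h
          · rw [h]; simp; positivity
          · field_simp; exact le_refl _

lemma phiNorm_neg {α : Type*} (G : Finset α) (v : α → ℝ) (j : α) :
    phiNorm G (-v) j = phiNorm G v j := by
  simp only [phiNorm, Pi.neg_apply, Left.neg_pos_iff, Left.neg_neg_iff, enormN_eq, neg_neg]
  rcases lt_trichotomy (v j) 0 with h | h | h
  · simp [h, h.not_gt]
  · simp [h]
  · simp [h, h.not_gt]

lemma group_dual {α : Type*} (G : Finset α) (θ β : α → ℝ) (w : ℝ)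
    (h1 : ∀ j ∈ G, β j ≠ 0 → θ j = w * β j / phiNorm G β j) :
    ∑ j ∈ G, θ j * β j = w * (enormP G β + enormN G β) := by
  have e : ∀ j ∈ G, θ j * β j = w * ((max (β j) 0) ^ 2 / enormP G β + (max (-β j) 0) ^ 2 / enormN G β) := by
    intro j hj
    rcases lt_trichotomy (β j) 0 with hb | hb | hb
    · rw [h1 j hj hb.ne, phiNorm, if_neg hb.not_gt, if_pos hb, max_eq_right hb.le,
        max_eq_left (by linarith)]
      ring
    · simp [hb]
    · rw [h1 j hj hb.ne', phiNorm, if_pos hb, max_eq_left hb.le, max_eq_right (by linarith)]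
      ring
  rw [Finset.sum_congr rfl e, ← Finset.mul_sum, Finset.sum_add_distrib, ← Finset.sum_div,
    ← Finset.sum_div]
  simp only [enormP, enormN, Real.div_sqrt]

lemma sum_groups {p K : ℕ} (G : Fin K → Finset (Fin p))
    (hcover : ∀ j : Fin p, ∃ k, j ∈ G k)
    (hdisj : ∀ k l : Fin K, k ≠ l → Disjoint (G k) (G l)) (f : Fin p → ℝ) :
    ∑ j, f j = ∑ k, ∑ j ∈ G k, f j := by
  rw [← Finset.sum_biUnion (fun k _ l _ h => hdisj k l h)]
  apply Finset.sum_congr _ (fun _ _ => rfl)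
  ext j
  simpa using hcover j

lemma test_bound {p K : ℕ} (G : Fin K → Finset (Fin p))
    (hdisj : ∀ k l : Fin K, k ≠ l → Disjoint (G k) (G l)) (w : Fin K → ℝ) (hw : ∀ k, 0 < w k)
    (θ : Fin p → ℝ)
    (h : ∀ u : Fin p → ℝ, ∑ j, θ j * u j ≤ coopNorm G w u) (k : Fin K) :
    enormP (G k) θ ≤ w k := by
  have hu := h (fun j => if j ∈ G k then max (θ j) 0 else 0)
  have e1 : ∑ j, θ j * (if j ∈ G k then max (θ j) 0 else 0) = enormP (G k) θ ^ 2 := by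
    rw [enormP_sq]
    simp only [mul_ite, mul_zero, Finset.sum_ite_mem, Finset.univ_inter]
    apply Finset.sum_congr rfl
    intro j _
    rcases le_total (θ j) 0 with h | h <;> simp [h, sq]
  have e2 : coopNorm G w (fun j => if j ∈ G k then max (θ j) 0 else 0) = w k * enormP (G k) θ := by
    unfold coopNorm
    rw [Finset.sum_eq_single k]
    · congr 1
      have z : enormN (G k) (fun j => if j ∈ G k then max (θ j) 0 else 0) = 0 := by
        unfold enormN
        rw [Finset.sum_eq_zero, Real.sqrt_zero]
        intro j hj
        simp [hj]
      rw [z, add_zero]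
      unfold enormP
      congr 1
      apply Finset.sum_congr rfl
      intro j hj
      simp [hj]
    · intro l _ hl
      have hz : ∀ j ∈ G l, j ∉ G k := fun j hj => Finset.disjoint_left.1 (hdisj l k hl) hj
      unfold enormP enormN
      rw [Finset.sum_eq_zero, Finset.sum_eq_zero] <;> simp +contextual [hz]
    · simp
  rw [e1, e2] at hu
  by_contra hc
  push Not at hc
  have := hw k
  nlinarith

lemma quad_expand {p n : ℕ} (X : Matrix (Fin n) (Fin p) ℝ) (y : Fin n → ℝ) (β d : Fin p → ℝ) (t : ℝ) :
    (1 / 2) * (∑ i, (y i - Matrix.mulVec X (β + t • d) i) ^ 2)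
      = (1 / 2) * (∑ i, (y i - Matrix.mulVec X β i) ^ 2)
        + t * ∑ j, (∑ i, X i j * (Matrix.mulVec X β i - y i)) * d j
        + t ^ 2 * ((1 / 2) * ∑ i, (Matrix.mulVec X d i) ^ 2) := by
  have e : ∑ j, (∑ i, X i j * (Matrix.mulVec X β i - y i)) * d j
      = ∑ i, (Matrix.mulVec X β i - y i) * Matrix.mulVec X d i := by
    simp only [Finset.sum_mul]
    rw [Finset.sum_comm]
    apply Finset.sum_congr rfl
    intro i _
    have : Matrix.mulVec X d i = ∑ j, X i j * d j := rfl
    rw [this, Finset.mul_sum]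
    apply Finset.sum_congr rfl
    intros; ring
  rw [e]
  simp only [Finset.mul_sum]
  rw [← Finset.sum_add_distrib, ← Finset.sum_add_distrib]
  apply Finset.sum_congr rfl
  intro i _
  rw [Matrix.mulVec_add, Matrix.mulVec_smul]
  simp only [Pi.add_apply, Pi.smul_apply, smul_eq_mul]
  ring

lemma le_of_small (a b c : ℝ) (h : ∀ t : ℝ, 0 < t → t ≤ 1 → a ≤ b + t * c) : a ≤ b := by
  by_contra hc
  push Not at hc
  have hd : 0 < a - b := sub_pos.2 hc
  have hpos : 0 < |c| + (a - b) := by positivity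
  have h1 := h ((a - b) / (2 * (|c| + (a - b)))) (by positivity) (by
    rw [div_le_one (by positivity)]
    have := abs_nonneg c
    linarith)
  have h2 : (a - b) / (2 * (|c| + (a - b))) * c ≤ (a - b) / (2 * (|c| + (a - b))) * (|c| + (a - b)) := by
    apply mul_le_mul_of_nonneg_left _ (by positivity)
    have := le_abs_self c
    linarith
  have h3 : (a - b) / (2 * (|c| + (a - b))) * (|c| + (a - b)) = (a - b) / 2 := by
    field_simp
  linarith

/-- characterization of the subdifferential of the coop-Lasso objective. -/
theorem coopLasso_subdifferential (p K n : ℕ) (hp : 1 ≤ p) (hn : 1 ≤ n)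
    (G : Fin K → Finset (Fin p))
    (hcover : ∀ j : Fin p, ∃ k, j ∈ G k)
    (hdisj : ∀ k l : Fin K, k ≠ l → Disjoint (G k) (G l))
    (w : Fin K → ℝ) (hw : ∀ k, 0 < w k)
    (X : Matrix (Fin n) (Fin p) ℝ) (y : Fin n → ℝ)
    (lam : ℝ) (hlam : 0 ≤ lam) (β g : Fin p → ℝ) :
    (∀ u : Fin p → ℝ,
        coopObj G w X y lam β + ∑ j, g j * (u j - β j) ≤ coopObj G w X y lam u) ↔
    ∃ θ : Fin p → ℝ,
      (∀ j, g j = (∑ i, X i j * (Matrix.mulVec X β i - y i)) + lam * θ j) ∧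
      (∀ k, ∀ j ∈ G k, β j ≠ 0 → θ j = w k * β j / phiNorm (G k) β j) ∧
      (∀ k, ∀ j ∈ G k, β j = 0 → phiNorm (G k) θ j ≤ w k) := by
  constructor
  · intro h
    have key : ∀ u : Fin p → ℝ, lam * coopNorm G w β +
        ∑ j, (g j - ∑ i, X i j * (Matrix.mulVec X β i - y i)) * (u j - β j)
          ≤ lam * coopNorm G w u := by
      intro u
      apply le_of_small _ _ ((1 / 2) * ∑ i, (Matrix.mulVec X (u - β) i) ^ 2)
      intro t ht ht1
      have h1 := h (β + t • (u - β))
      unfold coopObj at h1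
      rw [quad_expand] at h1
      have h2 : coopNorm G w (β + t • (u - β)) ≤ (1 - t) * coopNorm G w β + t * coopNorm G w u := by
        have e : β + t • (u - β) = (1 - t) • β + t • u := by
          ext j; simp; ring
        rw [e, ← coopNorm_smul G w (1 - t) (by linarith), ← coopNorm_smul G w t ht.le]
        exact coopNorm_add G w hw _ _
      have h3 := mul_le_mul_of_nonneg_left h2 hlam
      have e1 : ∑ j, g j * ((β + t • (u - β)) j - β j) = t * ∑ j, g j * (u j - β j) := by
        rw [Finset.mul_sum]
        apply Finset.sum_congr rfl
        intro j _
        simp; ring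
      rw [e1] at h1
      simp only [sub_mul, Finset.sum_sub_distrib, Pi.sub_apply] at h1 ⊢
      refine le_of_mul_le_mul_left ?_ ht
      linarith
    rcases hlam.eq_or_lt with h0 | hpos
    · subst h0
      refine ⟨fun j => ∑ k, if j ∈ G k then w k * β j / phiNorm (G k) β j else 0, ?_, ?_, ?_⟩
      · intro j
        have h1 := key (β + (fun j => g j - ∑ i, X i j * (Matrix.mulVec X β i - y i)))
        simp only [zero_mul, zero_add, Pi.add_apply, add_sub_cancel_left] at h1
        have h2 := (Finset.sum_eq_zero_iff_of_nonneg (fun i _ => mul_self_nonneg _)).1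
          (le_antisymm h1 (Finset.sum_nonneg fun i _ => mul_self_nonneg _)) j (Finset.mem_univ _)
        have h3 := mul_self_eq_zero.1 h2
        linarith
      · intro k j hj hb
        beta_reduce
        rw [Finset.sum_eq_single k]
        · simp [hj]
        · intro l _ hl
          exact if_neg (Finset.disjoint_left.1 (hdisj k l hl.symm) hj)
        · simp
      · intro k j hj hb
        have : phiNorm (G k) (fun j => ∑ k, if j ∈ G k then w k * β j / phiNorm (G k) β j else 0) j = 0 := by
          unfold phiNorm
          simp [hb]
        rw [this]
        exact (hw k).le
    · obtain ⟨θ, hθ⟩ : ∃ θ : Fin p → ℝ, ∀ j, g j - ∑ i, X i j * (Matrix.mulVec X β i - y i) = lam * θ j :=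
        ⟨fun j => (g j - ∑ i, X i j * (Matrix.mulVec X β i - y i)) / lam, fun j => by field_simp⟩
      have key2 : ∀ u : Fin p → ℝ, coopNorm G w β + (∑ j, θ j * u j - ∑ j, θ j * β j)
          ≤ coopNorm G w u := by
        intro u
        have h1 := key u
        simp only [hθ, mul_assoc] at h1
        rw [← Finset.mul_sum, ← mul_add] at h1
        have h2 := le_of_mul_le_mul_left h1 hpos
        simpa only [mul_sub, Finset.sum_sub_distrib] using h2
      have hs0 := key2 ((0 : ℝ) • β)
      have hs2 := key2 ((2 : ℝ) • β)
      rw [coopNorm_smul G w _ (by norm_num)] at hs0 hs2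
      simp only [Pi.smul_apply, smul_eq_mul, mul_left_comm _ (2 : ℝ), ← Finset.mul_sum, zero_mul,
        mul_zero, Finset.sum_const_zero] at hs0 hs2
      have heq : ∑ j, θ j * β j = coopNorm G w β := by linarith
      have hdual : ∀ u : Fin p → ℝ, ∑ j, θ j * u j ≤ coopNorm G w u := by
        intro u
        have := key2 u
        linarith
      have hP := test_bound G hdisj w hw θ hdual
      have hN : ∀ k, enormN (G k) θ ≤ w k := by
        intro k
        rw [enormN_eq]
        apply test_bound G hdisj w hw (-θ)
        intro u
        have h1 := hdual (-u)
        have e : coopNorm G w (-u) = coopNorm G w u := by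
          unfold coopNorm
          simp only [enormN_eq, neg_neg]
          apply Finset.sum_congr rfl
          intros; ring
        rw [e] at h1
        simpa using h1
      have hgrp : ∀ k, ∑ j ∈ G k, θ j * β j = w k * (enormP (G k) β + enormN (G k) β) := by
        have h1 := (Finset.sum_eq_sum_iff_of_le (s := Finset.univ)
          (fun k _ => group_le (G k) θ β (w k) (hP k) (hN k))).1
          ((sum_groups G hcover hdisj _).symm.trans heq)
        exact fun k => h1 k (Finset.mem_univ _)
      refine ⟨θ, fun j => by linarith [hθ j], ?_, ?_⟩
      · intro k j hj hb
        rcases lt_or_gt_of_ne hb with hb | hb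
        · rw [phiNorm, if_neg hb.not_gt, if_pos hb, enormN_eq]
          have h1 := group_eq (G k) (-θ) (-β) (w k) (hw k) (hN k)
            (by rw [enormN_eq, neg_neg]; exact hP k)
            (by
              simp only [enormN_eq, neg_neg, Pi.neg_apply, neg_mul_neg]
              rw [hgrp k, enormN_eq, add_comm]) j hj (by simpa using hb)
          simp only [Pi.neg_apply, mul_neg, neg_div] at h1
          linarith
        · rw [phiNorm, if_pos hb]
          exact group_eq (G k) θ β (w k) (hw k) (hP k) (hN k) (hgrp k) j hj hb
      · intro k j hj hb
        unfold phiNorm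
        split_ifs
        · exact hP k
        · exact hN k
        · exact (hw k).le
  · rintro ⟨θ, hg, h1, h2⟩ u
    have hP : ∀ k, enormP (G k) θ ≤ w k := fun k =>
      group_bound (G k) θ β (w k) (hw k) (h1 k) (h2 k)
    have hN : ∀ k, enormN (G k) θ ≤ w k := fun k => by
      rw [enormN_eq]
      apply group_bound (G k) (-θ) (-β) (w k) (hw k)
      · intro j hj hb
        rw [phiNorm_neg]
        simp only [Pi.neg_apply, mul_neg, neg_div, ne_eq, neg_eq_zero] at hb ⊢
        rw [h1 k j hj hb]
      · intro j hj hb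
        rw [phiNorm_neg]
        exact h2 k j hj (by simpa using hb)
    have hu : ∑ j, θ j * u j ≤ coopNorm G w u := by
      rw [sum_groups G hcover hdisj]
      exact Finset.sum_le_sum fun k _ => group_le (G k) θ u (w k) (hP k) (hN k)
    have hb : ∑ j, θ j * β j = coopNorm G w β := by
      rw [sum_groups G hcover hdisj]
      exact Finset.sum_congr rfl fun k _ => group_dual (G k) θ β (w k) (h1 k)
    have hq := quad_expand X y β (u - β) 1
    have e : β + (1 : ℝ) • (u - β) = u := by simp
    rw [e] at hq
    unfold coopObj
    rw [hq]
    have hnn : 0 ≤ ∑ i, (Matrix.mulVec X (u - β) i) ^ 2 := Finset.sum_nonneg fun _ _ => sq_nonneg _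
    have hl := mul_le_mul_of_nonneg_left hu hlam
    have eg : ∑ j, g j * (u j - β j) =
        ∑ j, (∑ i, X i j * (Matrix.mulVec X β i - y i)) * (u - β) j
          + lam * (∑ j, θ j * u j - ∑ j, θ j * β j) := by
      rw [← Finset.sum_sub_distrib, Finset.mul_sum, ← Finset.sum_add_distrib]
      apply Finset.sum_congr rfl
      intro j _
      rw [hg j]
      simp only [Pi.sub_apply]
      ring
    rw [eg, hb]
    linarith
end

section
/- Assume the design is orthonormal, i.e., XᵀX = I_p, and let β̂ols = Xᵀy. Then the unique global minimizer β̂ of the coop-Lasso objective L satisfies, for every k and every j ∈ G_k: β̂_j = 0 if β̂ols_j = 0, and otherwise β̂_j = (1 − λ w_k / ‖φ_j(β̂ols_{G_k})‖)⁺ · β̂ols_j, where (t)⁺ = max(0, t). -/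
open scoped BigOperators

lemma coop_scalar (P μ : ℝ) (hP : 0 ≤ P) (hμ : 0 ≤ μ) (c : ℝ) (hc : c = max (1 - μ / P) 0) :
    0 ≤ c ∧ c ≤ 1 ∧ (1 - c) * P ≤ μ ∧ c * (1 - c) * P ^ 2 = μ * (c * P) := by
  have hd : 0 ≤ μ / P := div_nonneg hμ hP
  rcases hP.eq_or_lt with h | h
  · subst h
    simp at hc
    subst hc
    simpa using hμ
  · have e : μ / P * P = μ := by field_simp
    rcases le_total (1 - μ / P) 0 with h1 | h1
    · rw [max_eq_right h1] at hc
      subst hc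
      refine ⟨le_rfl, zero_le_one, ?_, by ring⟩
      nlinarith
    · rw [max_eq_left h1] at hc
      subst hc
      refine ⟨h1, by linarith, by linarith [e], ?_⟩
      linear_combination ((1 - μ / P) * P) * e

lemma coop_group {α : Type*} (G : Finset α) (b u s : α → ℝ) (μ : ℝ) (hμ : 0 ≤ μ) (c d : ℝ)
    (hc : c = max (1 - μ / enormP G b) 0) (hd : d = max (1 - μ / enormN G b) 0)
    (hs : ∀ j ∈ G, s j = c * max (b j) 0 - d * max (-b j) 0) :
    (1 / 2) * ∑ j ∈ G, (s j - b j) ^ 2 + μ * (enormP G s + enormN G s)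
      + (1 / 2) * ∑ j ∈ G, (u j - s j) ^ 2
      ≤ (1 / 2) * ∑ j ∈ G, (u j - b j) ^ 2 + μ * (enormP G u + enormN G u) := by
  have hP0 : ∀ v : α → ℝ, 0 ≤ enormP G v := fun v => Real.sqrt_nonneg _
  have hN0 : ∀ v : α → ℝ, 0 ≤ enormN G v := fun v => Real.sqrt_nonneg _
  have hPsq : enormP G b ^ 2 = ∑ j ∈ G, (max (b j) 0) ^ 2 :=
    Real.sq_sqrt (Finset.sum_nonneg fun _ _ => sq_nonneg _)
  have hNsq : enormN G b ^ 2 = ∑ j ∈ G, (max (-b j) 0) ^ 2 :=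
    Real.sq_sqrt (Finset.sum_nonneg fun _ _ => sq_nonneg _)
  obtain ⟨c0, c1, c2, c3⟩ := coop_scalar _ μ (hP0 b) hμ c hc
  obtain ⟨d0, d1, d2, d3⟩ := coop_scalar _ μ (hN0 b) hμ d hd
  have hPs : enormP G s = c * enormP G b := by
    unfold enormP
    rw [← Real.sqrt_sq c0, ← Real.sqrt_mul (sq_nonneg c), Finset.mul_sum]
    congr 1
    refine Finset.sum_congr rfl fun j hj => ?_
    rw [hs j hj, ← mul_pow]
    congr 1
    rcases le_total (b j) 0 with h | h
    · rw [max_eq_right h, max_eq_left (by linarith : 0 ≤ -b j), mul_zero, max_eq_right]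
      nlinarith
    · rw [max_eq_left h, max_eq_right (by linarith : -b j ≤ 0), max_eq_left] <;> nlinarith
  have hNs : enormN G s = d * enormN G b := by
    unfold enormN
    rw [← Real.sqrt_sq d0, ← Real.sqrt_mul (sq_nonneg d), Finset.mul_sum]
    congr 1
    refine Finset.sum_congr rfl fun j hj => ?_
    rw [hs j hj, ← mul_pow]
    congr 1
    rcases le_total (b j) 0 with h | h
    · rw [max_eq_right h, max_eq_left (by linarith : 0 ≤ -b j), max_eq_left] <;> nlinarith
    · rw [max_eq_left h, max_eq_right (by linarith : -b j ≤ 0), mul_zero, max_eq_right]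
      nlinarith
  have hcsP : ∑ j ∈ G, max (b j) 0 * max (u j) 0 ≤ enormP G b * enormP G u :=
    Real.sum_mul_le_sqrt_mul_sqrt _ _ _
  have hcsN : ∑ j ∈ G, max (-b j) 0 * max (-u j) 0 ≤ enormN G b * enormN G u :=
    Real.sum_mul_le_sqrt_mul_sqrt _ _ _
  have hgu : ∑ j ∈ G, (b j - s j) * u j ≤ μ * (enormP G u + enormN G u) := by
    calc ∑ j ∈ G, (b j - s j) * u j
        ≤ ∑ j ∈ G, ((1 - c) * (max (b j) 0 * max (u j) 0)
            + (1 - d) * (max (-b j) 0 * max (-u j) 0)) := by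
          refine Finset.sum_le_sum fun j hj => ?_
          rw [hs j hj]
          have h1 : u j ≤ max (u j) 0 := le_max_left _ _
          have h2 : -u j ≤ max (-u j) 0 := le_max_left _ _
          have h3 : b j = max (b j) 0 - max (-b j) 0 := by
            rcases le_total (b j) 0 with h | h
            · rw [max_eq_right h, max_eq_left (by linarith)]; ring
            · rw [max_eq_left h, max_eq_right (by linarith)]; ring
          have h4 := mul_le_mul_of_nonneg_left h1
            (mul_nonneg (sub_nonneg.2 c1) (le_max_right (b j) 0))
          have h5 := mul_le_mul_of_nonneg_left h2
            (mul_nonneg (sub_nonneg.2 d1) (le_max_right (-b j) 0))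
          have h6 : (b j - (c * max (b j) 0 - d * max (-b j) 0)) * u j
              = (1 - c) * max (b j) 0 * u j + (1 - d) * max (-b j) 0 * (-u j) := by
            linear_combination u j * h3
          rw [h6]
          linarith
      _ = (1 - c) * ∑ j ∈ G, max (b j) 0 * max (u j) 0
            + (1 - d) * ∑ j ∈ G, max (-b j) 0 * max (-u j) 0 := by
          rw [Finset.sum_add_distrib, Finset.mul_sum, Finset.mul_sum]
      _ ≤ μ * (enormP G u + enormN G u) := by
          have h1 := mul_le_mul_of_nonneg_left hcsP (sub_nonneg.2 c1)
          have h2 := mul_le_mul_of_nonneg_left hcsN (sub_nonneg.2 d1)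
          have h3 := mul_le_mul_of_nonneg_right c2 (hP0 u)
          have h4 := mul_le_mul_of_nonneg_right d2 (hN0 u)
          linarith
  have hgs : ∑ j ∈ G, (b j - s j) * s j = μ * (enormP G s + enormN G s) := by
    rw [hPs, hNs, mul_add, ← c3, ← d3, hPsq, hNsq, Finset.mul_sum, Finset.mul_sum,
      ← Finset.sum_add_distrib]
    refine Finset.sum_congr rfl fun j hj => ?_
    rw [hs j hj]
    rcases le_total (b j) 0 with h | h
    · rw [max_eq_right h, max_eq_left (by linarith : 0 ≤ -b j)]; ring
    · rw [max_eq_left h, max_eq_right (by linarith : -b j ≤ 0)]; ring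
  have hid : (1 / 2) * ∑ j ∈ G, (u j - b j) ^ 2 = (1 / 2) * ∑ j ∈ G, (s j - b j) ^ 2
      + (1 / 2) * ∑ j ∈ G, (u j - s j) ^ 2
      - ∑ j ∈ G, (b j - s j) * u j + ∑ j ∈ G, (b j - s j) * s j := by
    simp only [Finset.mul_sum]
    rw [← Finset.sum_add_distrib, ← Finset.sum_sub_distrib, ← Finset.sum_add_distrib]
    refine Finset.sum_congr rfl fun j _ => ?_
    ring
  linarith

lemma coop_quad {p n : ℕ} (X : Matrix (Fin n) (Fin p) ℝ) (y : Fin n → ℝ)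
    (hX : X.transpose * X = 1) (b : Fin p → ℝ) (hb : ∀ j, b j = ∑ i, X i j * y i)
    (u : Fin p → ℝ) :
    ∑ i, (y i - Matrix.mulVec X u i) ^ 2
      = ∑ j, (u j - b j) ^ 2 + (∑ i, y i ^ 2 - ∑ j, b j ^ 2) := by
  have h1 : ∑ i, Matrix.mulVec X u i * Matrix.mulVec X u i = ∑ j, u j * u j := by
    change Matrix.mulVec X u ⬝ᵥ Matrix.mulVec X u = u ⬝ᵥ u
    rw [Matrix.dotProduct_mulVec, ← Matrix.mulVec_transpose, Matrix.mulVec_mulVec, hX,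
      Matrix.one_mulVec]
  have h2 : ∑ i, y i * Matrix.mulVec X u i = ∑ j, b j * u j := by
    change y ⬝ᵥ Matrix.mulVec X u = b ⬝ᵥ u
    rw [Matrix.dotProduct_mulVec, ← Matrix.mulVec_transpose]
    congr 1
    funext j
    rw [hb j]
    rfl
  have e1 : ∑ i, (y i - Matrix.mulVec X u i) ^ 2 = ∑ i, y i ^ 2
      - 2 * ∑ i, y i * Matrix.mulVec X u i
      + ∑ i, Matrix.mulVec X u i * Matrix.mulVec X u i := by
    rw [Finset.mul_sum, ← Finset.sum_sub_distrib, ← Finset.sum_add_distrib]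
    exact Finset.sum_congr rfl fun i _ => by ring
  have e2 : ∑ j, (u j - b j) ^ 2 = ∑ j, u j * u j - 2 * ∑ j, b j * u j + ∑ j, b j ^ 2 := by
    rw [Finset.mul_sum, ← Finset.sum_sub_distrib, ← Finset.sum_add_distrib]
    exact Finset.sum_congr rfl fun i _ => by ring
  rw [e1, e2, h1, h2]
  ring

/-- closed-form of the coop-Lasso estimate under orthonormal design
`XᵀX = I_p`: with `β̂ols = Xᵀy`, the global minimizer `β̂` of the objective satisfies
`β̂_j = 0` when `β̂ols_j = 0`, and otherwise
`β̂_j = (1 − λ w_k/‖φ_j(β̂ols_{G_k})‖)⁺ β̂ols_j`. -/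
theorem coopLasso_orthonormal_closed_form (p K n : ℕ) (hp : 1 ≤ p) (hpn : p ≤ n)
    (G : Fin K → Finset (Fin p))
    (hcover : ∀ j : Fin p, ∃ k, j ∈ G k)
    (hdisj : ∀ k l : Fin K, k ≠ l → Disjoint (G k) (G l))
    (w : Fin K → ℝ) (hw : ∀ k, 0 < w k)
    (X : Matrix (Fin n) (Fin p) ℝ) (y : Fin n → ℝ)
    (hX : X.transpose * X = 1)
    (lam : ℝ) (hlam : 0 ≤ lam)
    (βols : Fin p → ℝ) (hols : ∀ j, βols j = ∑ i, X i j * y i)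
    (βhat : Fin p → ℝ)
    (hmin : ∀ u : Fin p → ℝ, coopObj G w X y lam βhat ≤ coopObj G w X y lam u) :
    ∀ k, ∀ j ∈ G k,
      (βols j = 0 → βhat j = 0) ∧
      (βols j ≠ 0 →
        βhat j = max (1 - lam * w k / phiNorm (G k) βols j) 0 * βols j) := by
  have hsplit : ∀ f : Fin p → ℝ, ∑ j, f j = ∑ k, ∑ j ∈ G k, f j := by
    intro f
    rw [← Finset.sum_biUnion (fun k _ l _ hkl => hdisj k l hkl)]
    refine Finset.sum_congr ?_ fun _ _ => rfl
    ext j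
    simpa using hcover j
  choose κ hκ using hcover
  have hκu : ∀ k, ∀ j ∈ G k, κ j = k := by
    intro k j hj
    by_contra h
    exact Finset.disjoint_left.1 (hdisj _ _ h) (hκ j) hj
  let s : Fin p → ℝ := fun j =>
    max (1 - lam * w (κ j) / enormP (G (κ j)) βols) 0 * max (βols j) 0
      - max (1 - lam * w (κ j) / enormN (G (κ j)) βols) 0 * max (-βols j) 0
  have hs : ∀ k, ∀ j ∈ G k, s j =
      max (1 - lam * w k / enormP (G k) βols) 0 * max (βols j) 0
      - max (1 - lam * w k / enormN (G k) βols) 0 * max (-βols j) 0 := by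
    intro k j hj
    have := hκu k j hj
    subst this
    rfl
  have hobj : ∀ u, coopObj G w X y lam u =
      ∑ k, ((1 / 2) * ∑ j ∈ G k, (u j - βols j) ^ 2
        + lam * w k * (enormP (G k) u + enormN (G k) u))
      + (1 / 2) * (∑ i, y i ^ 2 - ∑ j, βols j ^ 2) := by
    intro u
    unfold coopObj coopNorm
    rw [coop_quad X y hX βols hols u, hsplit (fun j => (u j - βols j) ^ 2),
      Finset.sum_add_distrib, Finset.mul_sum (a := lam), mul_add, Finset.mul_sum]
    simp only [mul_assoc]
    ring
  have hle := hmin s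
  rw [hobj, hobj] at hle
  have hsum := Finset.sum_le_sum fun k (_ : k ∈ Finset.univ) =>
    coop_group (G k) βols βhat s (lam * w k) (mul_nonneg hlam (hw k).le) _ _ rfl rfl (hs k)
  rw [Finset.sum_add_distrib, ← Finset.mul_sum Finset.univ _ (1 / 2),
    ← hsplit (fun j => (βhat j - s j) ^ 2)] at hsum
  have hz : ∑ j, (βhat j - s j) ^ 2 = 0 :=
    le_antisymm (by linarith) (Finset.sum_nonneg fun _ _ => sq_nonneg _)
  have heq : ∀ j, βhat j = s j := by
    intro j
    have := (Finset.sum_eq_zero_iff_of_nonneg (fun _ _ => sq_nonneg _)).1 hz j (Finset.mem_univ j)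
    exact sub_eq_zero.1 (pow_eq_zero_iff two_ne_zero |>.1 this)
  intro k j hj
  rw [heq, hs k j hj]
  refine ⟨fun h => by simp [h], fun h => ?_⟩
  rcases lt_or_gt_of_ne h with h | h
  · rw [phiNorm, if_neg h.not_gt, if_pos h, max_eq_right h.le,
      max_eq_left (by linarith : 0 ≤ -βols j)]
    ring
  · rw [phiNorm, if_pos h, max_eq_left (le_of_lt h), max_eq_right (by linarith : -βols j ≤ 0)]
    ring
end

section
/- Assume the design is orthonormal, i.e., XᵀX = I_p, let β̂ols = Xᵀy, fix α ∈ [0,1] and λ ≥ 0, and let β̂sgl be a global minimizer of the sparse group-Lasso objective β ↦ (1/2)‖y − Xβ‖² + λ(1−α)‖β‖_group + λα‖β‖_1. Define the intermediate vector β̃ by β̃_j = (1 − λα/|β̂ols_j|)⁺ β̂ols_j (set β̃_j = 0 when β̂ols_j = 0). Then for every k and every j ∈ G_k: β̂sgl_j = 0 if β̃_{G_k} = 0, and otherwise β̂sgl_j = (1 − λ(1−α) w_k / ‖β̃_{G_k}‖)⁺ · β̃_j, where (t)⁺ = max(0, t). -/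
open scoped BigOperators

/-- The sparse group-Lasso objective
`(1/2)‖y − Xβ‖² + λ(1−α)‖β‖_group + λα‖β‖₁`. -/
noncomputable def sglObj {p K n : ℕ} (G : Fin K → Finset (Fin p)) (w : Fin K → ℝ)
    (X : Matrix (Fin n) (Fin p) ℝ) (y : Fin n → ℝ) (lam α : ℝ) (β : Fin p → ℝ) : ℝ :=
  (1 / 2) * (∑ i, (y i - Matrix.mulVec X β i) ^ 2) +
    lam * (1 - α) * groupNorm G w β + lam * α * (∑ j, |β j|)

theorem sgl_soft (a b t : ℝ) (ha : 0 ≤ a)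
    (ht : t = if b = 0 then 0 else max (1 - a / |b|) 0 * b) :
    |b - t| ≤ a ∧ (b - t) * t = a * |t| := by
  by_cases hb : b = 0
  · simp [hb] at ht
    simp [hb, ht, ha]
  · rw [if_neg hb] at ht
    have hpos : 0 < |b| := abs_pos.mpr hb
    rcases le_total a |b| with h | h
    · have h1 : a / |b| ≤ 1 := (div_le_one hpos).mpr h
      have h0 : 0 ≤ a / |b| := by positivity
      rw [max_eq_left (by linarith)] at ht
      have hbt : b - t = a / |b| * b := by rw [ht]; ring
      have habs : |t| = (1 - a / |b|) * |b| := by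
        rw [ht, abs_mul, abs_of_nonneg (by linarith : 0 ≤ 1 - a / |b|)]
      constructor
      · rw [hbt, abs_mul, abs_of_nonneg h0, div_mul_cancel₀ _ hpos.ne']
      · rw [hbt, habs, ht]
        have hbb : b * b = |b| * |b| := (abs_mul_abs_self b).symm
        have : a / |b| * |b| = a := div_mul_cancel₀ _ hpos.ne'
        calc a / |b| * b * ((1 - a / |b|) * b) = a / |b| * (1 - a / |b|) * (b * b) := by ring
          _ = (a / |b| * |b|) * ((1 - a / |b|) * |b|) := by rw [hbb]; ring
          _ = _ := by rw [this]
    · have h1 : 1 ≤ a / |b| := (one_le_div hpos).mpr h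
      rw [max_eq_right (by linarith), zero_mul] at ht
      simp [ht, h]

theorem sgl_group {ι : Type*} (S : Finset ι) (b t u T : ι → ℝ) (a m : ℝ) (ha : 0 ≤ a)
    (hm : 0 ≤ m)
    (ht : ∀ j, t j = if b j = 0 then 0 else max (1 - a / |b j|) 0 * b j)
    (hT : ∀ j ∈ S, T j = max (1 - m / enorm S t) 0 * t j) :
    (∑ j ∈ S, ((1 / 2) * T j ^ 2 - b j * T j + a * |T j|)) + m * enorm S T
      + (1 / 2) * ∑ j ∈ S, (u j - T j) ^ 2 ≤
    (∑ j ∈ S, ((1 / 2) * u j ^ 2 - b j * u j + a * |u j|)) + m * enorm S u := by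
  set N : ℝ := enorm S t with hN
  set c : ℝ := max (1 - m / N) 0 with hc
  have hc0 : 0 ≤ c := le_max_right _ _
  have hN0 : 0 ≤ N := Real.sqrt_nonneg _
  have hNsq : N ^ 2 = ∑ j ∈ S, t j ^ 2 :=
    Real.sq_sqrt (Finset.sum_nonneg fun _ _ => sq_nonneg _)
  have hNT : (enorm S T : ℝ) = c * N := by
    have h : ∑ j ∈ S, T j ^ 2 = (c * N) ^ 2 := by
      rw [mul_pow, hNsq, Finset.mul_sum]
      exact Finset.sum_congr rfl fun j hj => by rw [hT j hj]; ring
    show Real.sqrt (∑ j ∈ S, T j ^ 2) = c * N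
    rw [h, Real.sqrt_sq (mul_nonneg hc0 hN0)]
  have hCS : ∑ j ∈ S, t j * u j ≤ N * (enorm S u : ℝ) :=
    Real.sum_mul_le_sqrt_mul_sqrt S t u
  have hU0 : 0 ≤ (enorm S u : ℝ) := Real.sqrt_nonneg _
  set U : ℝ := enorm S u with hU
  -- pointwise reduction
  have hpt : ∑ j ∈ S, ((1 / 2) * T j ^ 2 - b j * T j + a * |T j| + (1 / 2) * (u j - T j) ^ 2
        + ((c - 1) * (t j * u j) - c * (c - 1) * t j ^ 2)) ≤
      ∑ j ∈ S, ((1 / 2) * u j ^ 2 - b j * u j + a * |u j|) := by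
    refine Finset.sum_le_sum fun j hj => ?_
    obtain ⟨h1, h2⟩ := sgl_soft a (b j) (t j) ha (ht j)
    have h3 : (b j - t j) * u j ≤ a * |u j| :=
      calc (b j - t j) * u j ≤ |(b j - t j) * u j| := le_abs_self _
        _ = |b j - t j| * |u j| := abs_mul _ _
        _ ≤ _ := mul_le_mul_of_nonneg_right h1 (abs_nonneg _)
    have h4 : a * |T j| = (b j - t j) * (c * t j) := by
      rw [hT j hj, abs_mul, abs_of_nonneg hc0]
      linear_combination (-c) * h2
    rw [h4, hT j hj]
    nlinarith [h3]
  simp only [Finset.sum_add_distrib, Finset.sum_sub_distrib, ← Finset.mul_sum] at hpt ⊢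
  rw [hNT]
  rw [← hNsq] at hpt
  set P := ∑ j ∈ S, t j * u j
  have key : 0 ≤ (c - 1) * P - c * (c - 1) * N ^ 2 + m * U - m * (c * N) := by
    rcases hN0.eq_or_lt with h0 | hpos
    · have hc1 : c = 1 := by rw [hc, ← h0]; simp
      rw [hc1, ← h0]
      have := mul_nonneg hm hU0
      linarith
    · rcases le_total m N with h | h
      · have hc1 : c = 1 - m / N := max_eq_left (by
          have := (div_le_one hpos).mpr h
          linarith)
        have hq : 0 ≤ m / N := by positivity
        have hmq : m = m / N * N := (div_mul_cancel₀ _ hpos.ne').symm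
        generalize m / N = q at *
        rw [hc1, hmq]
        nlinarith [mul_le_mul_of_nonneg_left hCS hq]
      · have hc1 : c = 0 := max_eq_right (by
          have := (one_le_div hpos).mpr h
          linarith)
        rw [hc1]
        nlinarith [mul_le_mul_of_nonneg_right h hU0]
  linarith

theorem sgl_quad {p n : ℕ} (X : Matrix (Fin n) (Fin p) ℝ) (y : Fin n → ℝ)
    (hX : X.transpose * X = 1) (b : Fin p → ℝ) (hols : ∀ j, b j = ∑ i, X i j * y i)
    (β : Fin p → ℝ) :
    ∑ i, (y i - Matrix.mulVec X β i) ^ 2 =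
      ∑ i, y i ^ 2 + ∑ j, (β j ^ 2 - 2 * (b j * β j)) := by
  have h1 : ∑ i, (Matrix.mulVec X β i) ^ 2 = ∑ j, β j ^ 2 := by
    have : (X.mulVec β) ⬝ᵥ (X.mulVec β) = β ⬝ᵥ β := by
      rw [Matrix.dotProduct_mulVec, Matrix.vecMul_mulVec, hX, Matrix.vecMul_one]
    simpa [dotProduct, sq] using this
  have h2 : ∑ i, y i * Matrix.mulVec X β i = ∑ j, b j * β j := by
    simp only [hols, Matrix.mulVec, dotProduct, Finset.mul_sum, Finset.sum_mul]
    rw [Finset.sum_comm]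
    exact Finset.sum_congr rfl fun _ _ => Finset.sum_congr rfl fun _ _ => by ring
  rw [Finset.sum_sub_distrib, ← Finset.mul_sum, ← h1, ← h2, Finset.mul_sum,
    ← Finset.sum_sub_distrib, ← Finset.sum_add_distrib]
  exact Finset.sum_congr rfl fun _ _ => by ring

/-- closed-form of the sparse group-Lasso estimate under orthonormal
design `XᵀX = I_p`: with `β̂ols = Xᵀy` and the soft-thresholded intermediate vector
`β̃_j = (1 − λα/|β̂ols_j|)⁺ β̂ols_j` (with `β̃_j = 0` when `β̂ols_j = 0`), the global
minimizer `β̂sgl` satisfies `β̂sgl_j = 0` when `β̃_{G_k} = 0`, and otherwise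
`β̂sgl_j = (1 − λ(1−α) w_k/‖β̃_{G_k}‖)⁺ β̃_j`. -/
theorem sparseGroupLasso_orthonormal_closed_form (p K n : ℕ) (hp : 1 ≤ p) (hpn : p ≤ n)
    (G : Fin K → Finset (Fin p))
    (hcover : ∀ j : Fin p, ∃ k, j ∈ G k)
    (hdisj : ∀ k l : Fin K, k ≠ l → Disjoint (G k) (G l))
    (w : Fin K → ℝ) (hw : ∀ k, 0 < w k)
    (X : Matrix (Fin n) (Fin p) ℝ) (y : Fin n → ℝ)
    (hX : X.transpose * X = 1)
    (lam α : ℝ) (hlam : 0 ≤ lam) (hα0 : 0 ≤ α) (hα1 : α ≤ 1)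
    (βols : Fin p → ℝ) (hols : ∀ j, βols j = ∑ i, X i j * y i)
    (βtilde : Fin p → ℝ)
    (htilde : ∀ j, βtilde j =
      if βols j = 0 then 0 else max (1 - lam * α / |βols j|) 0 * βols j)
    (βhat : Fin p → ℝ)
    (hmin : ∀ u : Fin p → ℝ, sglObj G w X y lam α βhat ≤ sglObj G w X y lam α u) :
    ∀ k, ∀ j ∈ G k,
      ((∀ l ∈ G k, βtilde l = 0) → βhat j = 0) ∧
      ((∃ l ∈ G k, βtilde l ≠ 0) →
        βhat j = max (1 - lam * (1 - α) * w k / enorm (G k) βtilde) 0 * βtilde j) := by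
  have hsum : ∀ f : Fin p → ℝ, ∑ j, f j = ∑ k, ∑ j ∈ G k, f j := by
    intro f
    rw [← Finset.sum_biUnion (fun k _ l _ hkl => hdisj k l hkl)]
    refine Finset.sum_congr ?_ fun _ _ => rfl
    ext j
    simpa using hcover j
  have hobj : ∀ β : Fin p → ℝ, sglObj G w X y lam α β = (1 / 2) * ∑ i, y i ^ 2 +
      ∑ k, ((∑ j ∈ G k, ((1 / 2) * β j ^ 2 - βols j * β j + (lam * α) * |β j|))
        + (lam * (1 - α) * w k) * enorm (G k) β) := by
    intro β
    unfold sglObj groupNorm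
    rw [sgl_quad X y hX βols hols, Finset.sum_add_distrib, ← hsum, Finset.sum_add_distrib,
      ← Finset.mul_sum, mul_add, Finset.mul_sum Finset.univ (fun j => β j ^ 2 - _),
      Finset.mul_sum Finset.univ (fun k => w k * _)]
    have e1 : ∑ j, 1 / 2 * (β j ^ 2 - 2 * (βols j * β j)) =
        ∑ j, (1 / 2 * β j ^ 2 - βols j * β j) :=
      Finset.sum_congr rfl fun _ _ => by ring
    have e2 : ∑ k, lam * (1 - α) * (w k * enorm (G k) β) =
        ∑ k, lam * (1 - α) * w k * enorm (G k) β :=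
      Finset.sum_congr rfl fun _ _ => by ring
    rw [e1, e2]
    ring
  choose g hg using hcover
  have hguniq : ∀ k, ∀ j ∈ G k, g j = k := by
    intro k j hj
    by_contra hne
    exact Finset.disjoint_left.mp (hdisj _ _ hne) (hg j) hj
  let T : Fin p → ℝ := fun j =>
    max (1 - lam * (1 - α) * w (g j) / enorm (G (g j)) βtilde) 0 * βtilde j
  have hT : ∀ k, ∀ j ∈ G k,
      T j = max (1 - lam * (1 - α) * w k / enorm (G k) βtilde) 0 * βtilde j := by
    intro k j hj
    simp only [T, hguniq k j hj]
  have hgrp := Finset.sum_le_sum fun k (_ : k ∈ (Finset.univ : Finset (Fin K))) =>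
    sgl_group (G k) βols βtilde βhat T (lam * α) (lam * (1 - α) * w k)
      (mul_nonneg hlam hα0)
      (mul_nonneg (mul_nonneg hlam (by linarith)) (hw k).le) htilde (hT k)
  rw [Finset.sum_add_distrib, ← Finset.mul_sum, ← hsum] at hgrp
  have hle := hmin T
  rw [hobj, hobj] at hle
  have hz : ∑ j, (βhat j - T j) ^ 2 = 0 :=
    le_antisymm (by linarith) (Finset.sum_nonneg fun _ _ => sq_nonneg _)
  have heq : ∀ j, βhat j = T j := by
    intro j
    have := (Finset.sum_eq_zero_iff_of_nonneg (fun _ _ => sq_nonneg _)).mp hz j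
      (Finset.mem_univ j)
    exact sub_eq_zero.mp (pow_eq_zero_iff (two_ne_zero)|>.mp this)
  intro k j hj
  refine ⟨fun h => ?_, fun _ => ?_⟩
  · rw [heq, hT k j hj, h j hj, mul_zero]
  · rw [heq, hT k j hj]
end
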